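/- arXiv:1505.02968 — 2 statements merged into one kernel-verified Lean document; each statement's English description precedes it below -/
import Mathlib

section
/- Let p^e and q^f be prime powers greater than 1, let d₁ = φ(p^e) and d₂ = φ(q^f) (φ the Euler totient function), let A be the companion matrix of the cyclotomic polynomial Φ_{p^e} and B the companion matrix of Φ_{q^f}, both regarded as real matrices. If a real d₁×d₂ matrix M satisfies Aᵀ M B = M, then M is constant along diagonals in the sense that M_{k,l} = M_{k+1,l+1} for all 1 ≤ k ≤ d₁−1 and 1 ≤ l ≤ d₂−1. -/
open Matrix Polynomial

/-- The companion matrix (of size `d`) of a monic polynomial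
`p(x) = x^d + a_{d-1} x^{d-1} + ⋯ + a_1 x + a_0` of degree `d`: the `d × d` matrix `C`
with `1`s on the subdiagonal, last column equal to `(-a_0, …, -a_{d-1})ᵀ`, and all
other entries `0`. -/
def companionMatrix (d : ℕ) (p : Polynomial ℤ) : Matrix (Fin d) (Fin d) ℤ :=
  Matrix.of fun i j =>
    if (j : ℕ) = d - 1 then -(p.coeff i) else if (i : ℕ) = (j : ℕ) + 1 then 1 else 0

/-- Every column of a companion matrix except the last is the next standard basis vector. -/
theorem companionMatrix_col (d : ℕ) (p : Polynomial ℤ) (j : Fin d) (hj : (j : ℕ) + 1 < d) :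
    (fun i => ((companionMatrix d p).map (Int.cast : ℤ → ℝ)) i j) =
      Pi.single ⟨(j : ℕ) + 1, hj⟩ 1 := by
  have hne : (j : ℕ) ≠ d - 1 := by lia
  ext i
  simp [companionMatrix, hne, Pi.single_apply, Fin.ext_iff]

/-- Let `p^e` and `q^f` be prime powers greater than `1`, `d₁ = φ(p^e)`, `d₂ = φ(q^f)`,
`A` the companion matrix of the cyclotomic polynomial `Φ_{p^e}` and `B` that of `Φ_{q^f}`,
regarded as real matrices.  If a real `d₁ × d₂` matrix `M` satisfies `Aᵀ M B = M`, then
`M` is constant along diagonals: `M_{k,l} = M_{k+1,l+1}`. -/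
theorem constant_diagonals_of_companion_invariant
    (p q e f : ℕ) (hp : p.Prime) (hq : q.Prime) (he : 1 ≤ e) (hf : 1 ≤ f)
    (M : Matrix (Fin (Nat.totient (p ^ e))) (Fin (Nat.totient (q ^ f))) ℝ)
    (hM : ((companionMatrix (Nat.totient (p ^ e)) (cyclotomic (p ^ e) ℤ)).map
            (Int.cast : ℤ → ℝ))ᵀ * M *
          ((companionMatrix (Nat.totient (q ^ f)) (cyclotomic (q ^ f) ℤ)).map
            (Int.cast : ℤ → ℝ)) = M)
    (k : Fin (Nat.totient (p ^ e))) (l : Fin (Nat.totient (q ^ f)))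
    (hk : (k : ℕ) + 1 < Nat.totient (p ^ e)) (hl : (l : ℕ) + 1 < Nat.totient (q ^ f)) :
    M k l = M ⟨(k : ℕ) + 1, hk⟩ ⟨(l : ℕ) + 1, hl⟩ := by
  have hkl := congrFun (congrFun hM k) l
  rw [Matrix.mul_apply_eq_vecMul, Matrix.mul_apply_eq_vecMul] at hkl
  rw [← hkl]
  change (((fun i => ((companionMatrix _ _).map (Int.cast : ℤ → ℝ)) i k) ᵥ* M) ⬝ᵥ
    (fun j => ((companionMatrix _ _).map (Int.cast : ℤ → ℝ)) j l)) = _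
  rw [companionMatrix_col _ _ k hk, companionMatrix_col _ _ l hl]
  simp
end

section
/- Let p₁ < ⋯ < p_t be primes, e_i ≥ 1, d_i = φ(p_i^{e_i}), and let A_i be the companion matrix of the cyclotomic polynomial Φ_{p_i^{e_i}}. Set d = 1 + ∑_{i=1}^t d_i and let Λ be the block-diagonal d×d integer matrix diag(A₁, …, A_t, 1), whose final block is the 1×1 matrix (1). If Θ is a skew-symmetric real d×d matrix with ΛᵀΘΛ = Θ, then the last row and the last column of Θ vanish; that is, Θ has the block form Θ = [[Θ', 0],[0, 0]] for some skew-symmetric real (d−1)×(d−1) matrix Θ'. -/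
open Matrix Polynomial

/-- The block-diagonal matrix `Λ = diag(A₁, …, A_t, 1)`, where `A_i` is the companion
matrix of the cyclotomic polynomial `Φ_{p_i^{e_i}}` (of size `d_i = φ(p_i^{e_i})`) and the
final block is the `1 × 1` identity, regarded as a real matrix. -/
noncomputable def bigLambda (t : ℕ) (p e : Fin t → ℕ) :
    Matrix ((Σ i : Fin t, Fin (Nat.totient (p i ^ e i))) ⊕ Unit)
           ((Σ i : Fin t, Fin (Nat.totient (p i ^ e i))) ⊕ Unit) ℝ :=
  Matrix.fromBlocks
    (Matrix.blockDiagonal' fun i =>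
      (companionMatrix (Nat.totient (p i ^ e i)) (cyclotomic (p i ^ e i) ℤ)).map
        (Int.cast : ℤ → ℝ))
    0 0 (1 : Matrix Unit Unit ℝ)

/-- A row vector fixed by the companion matrix of a monic polynomial `p` with `p(1) ≠ 0` is zero. -/
theorem eq_zero_of_vecMul_companionMatrix_eq {d : ℕ} {p : Polynomial ℤ} (hmonic : p.Monic)
    (hdeg : p.natDegree = d) (hone : p.eval 1 ≠ 0) (v : Fin d → ℝ)
    (hv : v ᵥ* (companionMatrix d p).map (Int.cast : ℤ → ℝ) = v) : v = 0 := by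
  rcases d with _ | n
  · exact Subsingleton.elim _ _
  have hcol (j : Fin (n + 1)) :
      ∑ k, v k * ((companionMatrix (n + 1) p k j : ℤ) : ℝ) = v j := congrFun hv j
  have hstep (m : ℕ) (hm : m + 1 < n + 1) : v ⟨m + 1, hm⟩ = v ⟨m, by omega⟩ := by
    rw [← hcol ⟨m, by omega⟩, Finset.sum_eq_single ⟨m + 1, hm⟩]
    · have hne : m ≠ n := by omega
      simp [companionMatrix, hne]
    · intro k _ hk
      have hne : m ≠ n := by omega
      have hk' : (k : ℕ) ≠ m + 1 := fun h => hk (Fin.ext h)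
      simp [companionMatrix, hne, hk']
    · simp
  have hconst (m : ℕ) (hm : m < n + 1) : v ⟨m, hm⟩ = v 0 := by
    induction m with
    | zero => rfl
    | succ m ih => rw [hstep m hm, ih]
  have heval : p.eval 1 = ∑ k : Fin (n + 1), p.coeff k + 1 := by
    rw [eval_eq_sum_range, hdeg, Finset.sum_range_succ, ← hdeg, hmonic.coeff_natDegree, hdeg,
      Finset.sum_range]
    simp
  have hlast := hcol (Fin.last n)
  have hzero : v 0 * ((p.eval 1 : ℤ) : ℝ) = 0 := by
    have hv0 (k : Fin (n + 1)) : v k = v 0 := hconst k k.isLt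
    simp only [companionMatrix, hv0, of_apply, Fin.val_last, Nat.add_sub_cancel, if_true,
      ← Finset.mul_sum] at hlast
    rw [heval]
    push_cast at hlast ⊢
    rw [Finset.sum_neg_distrib] at hlast
    linarith
  have hv0 : v 0 = 0 := (mul_eq_zero.mp hzero).resolve_right (by exact_mod_cast hone)
  funext k
  exact (hconst k k.isLt).trans hv0

/-- Let `p₁ < ⋯ < p_t` be primes, `e_i ≥ 1`, and `Λ = diag(A₁, …, A_t, 1)` the
block-diagonal matrix whose blocks are the companion matrices of the `Φ_{p_i^{e_i}}`,
together with a final `1 × 1` block `(1)`.  If `Θ` is skew-symmetric with `ΛᵀΘΛ = Θ`,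
then the last row and the last column of `Θ` vanish, i.e. `Θ = [[Θ', 0], [0, 0]]`. -/
theorem last_row_col_vanish (t : ℕ) (p e : Fin t → ℕ)
    (hp : ∀ i, (p i).Prime) (he : ∀ i, 1 ≤ e i) (hmono : StrictMono p)
    (Θ : Matrix ((Σ i : Fin t, Fin (Nat.totient (p i ^ e i))) ⊕ Unit)
                ((Σ i : Fin t, Fin (Nat.totient (p i ^ e i))) ⊕ Unit) ℝ)
    (hskew : Θᵀ = -Θ)
    (hinv : (bigLambda t p e)ᵀ * Θ * bigLambda t p e = Θ) :
    ∀ x, Θ (Sum.inr ()) x = 0 ∧ Θ x (Sum.inr ()) = 0 := by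
  have hdiag : Θ (Sum.inr ()) (Sum.inr ()) = 0 := by
    have h := congrFun (congrFun hskew (Sum.inr ())) (Sum.inr ())
    simp only [transpose_apply, Matrix.neg_apply] at h
    linarith
  have hrow (i : Fin t) : (fun j => Θ (Sum.inr ()) (Sum.inl ⟨i, j⟩)) = 0 := by
    refine eq_zero_of_vecMul_companionMatrix_eq (cyclotomic.monic _ ℤ) (natDegree_cyclotomic _ ℤ)
      ?_ _ ?_
    · obtain ⟨k, hk⟩ := Nat.exists_eq_add_of_le' (he i)
      have := Fact.mk (hp i)
      rw [hk, eval_one_cyclotomic_prime_pow]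
      exact_mod_cast (hp i).ne_zero
    · funext j
      have h := congrFun (congrFun hinv (Sum.inr ())) (Sum.inl ⟨i, j⟩)
      conv_rhs => rw [← h]
      simp only [bigLambda, mul_apply, transpose_apply, vecMul, dotProduct, Fintype.sum_sum_type,
        Fintype.sum_sigma, fromBlocks_apply₁₁, fromBlocks_apply₁₂, fromBlocks_apply₂₁,
        fromBlocks_apply₂₂]
      rw [Finset.sum_eq_single i]
      · simp [blockDiagonal'_apply_eq]
      · intro i' _ hi'
        simp [blockDiagonal'_apply_ne _ _ _ hi']
      · simp
  have hlast : ∀ x, Θ (Sum.inr ()) x = 0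
    | Sum.inl ⟨i, j⟩ => congrFun (hrow i) j
    | Sum.inr () => hdiag
  refine fun x => ⟨hlast x, ?_⟩
  have h := congrFun (congrFun hskew (Sum.inr ())) x
  rwa [transpose_apply, Matrix.neg_apply, hlast x, neg_zero] at h
end
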